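/- Let A be a finite central arrangement in an ℓ-dimensional Euclidean space and m : A → ℤ a multiplicity with m(H) ≥ 0 for all H ∈ A. Then D(A,m) coincides with Ziegler's multiderivation module: D(A,m) = {ξ ∈ Der_S : ξ(α_H) ∈ α_H^{m(H)} S for all H ∈ A}, where Der_S is the S-module of ℝ-linear derivations of S. -/

import Mathlib

open MvPolynomial

noncomputable section CoxeterFormalization

/-! ### The ambient rings: `S = Sym(V*)`, `F = Frac(S)`, rational 1-forms.

We model the `ℓ`-dimensional Euclidean space `V` as `ℝ^ℓ` with its standard
(orthonormal) coordinates, so that `S = ℝ[x_0, …, x_{ℓ-1}]`, and a rational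
differential 1-form `ω = Σ ω_x dx_x` (equivalently, a rational derivation
`ξ = Σ ξ_x ∂_x`) is recorded by its component vector `(ω_x)_x : Fin ℓ → F`. -/

abbrev Spoly (ℓ : ℕ) := MvPolynomial (Fin ℓ) ℝ
abbrev Ffield (ℓ : ℕ) := FractionRing (Spoly ℓ)
abbrev OmF (ℓ : ℕ) := Fin ℓ → Ffield ℓ

variable {ℓ t : ℕ}

/-- The image of `S` in `F`: the "regular" (polynomial) rational functions. -/
def Sreg (ℓ : ℕ) : Set (Ffield ℓ) := Set.range (algebraMap (Spoly ℓ) (Ffield ℓ))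

def toF (p : Spoly ℓ) : Ffield ℓ := algebraMap (Spoly ℓ) (Ffield ℓ) p

/-- The linear form `α = Σ a_x · x_x ∈ V*` attached to a normal vector `a`. -/
def linForm (a : Fin ℓ → ℝ) : Spoly ℓ := ∑ x, MvPolynomial.C (a x) * MvPolynomial.X x

def linF (a : Fin ℓ → ℝ) : Ffield ℓ := toF (linForm a)

def cF (r : ℝ) : Ffield ℓ := toF (MvPolynomial.C r)

def XF (x : Fin ℓ) : Ffield ℓ := toF (MvPolynomial.X x)

/-- `Q = ∏_{H ∈ A} α_H`, as an element of `F`. -/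
def QF (A : Finset (Fin ℓ → ℝ)) : Ffield ℓ := toF (∏ a ∈ A, linForm a)

/-- `Q^m = ∏_{H ∈ A} α_H^{m(H)}` for an integral multiplicity `m`. -/
def QmF (A : Finset (Fin ℓ → ℝ)) (m : (Fin ℓ → ℝ) → ℤ) : Ffield ℓ :=
  ∏ a ∈ A, linF a ^ m a

/-- Ziegler's module `Ω(A,∞)` of logarithmic 1-forms:
`Q^N ω` and `(Q/α_H)^N dα_H ∧ ω` regular for `N ≫ 0`.  The wedge
`dα_H ∧ ω` is recorded by its components `a_x ω_y - a_y ω_x`. -/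
def OmegaInf (A : Finset (Fin ℓ → ℝ)) : Set (OmF ℓ) :=
  {ω | ∃ N : ℕ,
    (∀ x, QF A ^ N * ω x ∈ Sreg ℓ) ∧
    ∀ a ∈ A, ∀ x y,
      (QF A / linF a) ^ N * (cF (a x) * ω y - cF (a y) * ω x) ∈ Sreg ℓ}

/-- `Ω(A,m)` for an arbitrary multiplicity `m : A → ℤ`: those `ω ∈ Ω(A,∞)` with
`(Q/α_H)^N α_H^{m(H)} I*(dα_H, ω) ∈ S` for `N ≫ 0`; here
`I*(dα_H, ω) = Σ_x a_x ω_x` (the coordinates are orthonormal). -/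
def OmegaMult (A : Finset (Fin ℓ → ℝ)) (m : (Fin ℓ → ℝ) → ℤ) : Set (OmF ℓ) :=
  {ω ∈ OmegaInf A | ∃ N : ℕ,
    ∀ a ∈ A, (QF A / linF a) ^ N * linF a ^ m a * (∑ x, cF (a x) * ω x) ∈ Sreg ℓ}

/-! ### The action of `GL_ℓ(ℝ)` on `S`, `F` and on component vectors. -/

/-- Substitution `x_i ↦ Σ_j M_{i j} x_j`, i.e. `f ↦ f ∘ M`. -/
def matSub (M : Matrix (Fin ℓ) (Fin ℓ) ℝ) : Spoly ℓ →ₐ[ℝ] Spoly ℓ :=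
  MvPolynomial.aeval fun x => ∑ y, MvPolynomial.C (M x y) * MvPolynomial.X y

lemma matSub_comp (M N : Matrix (Fin ℓ) (Fin ℓ) ℝ) :
    (matSub M).comp (matSub N) = matSub (N * M) := by
  apply MvPolynomial.algHom_ext
  intro x
  simp only [matSub, AlgHom.coe_comp, Function.comp_apply, aeval_X, map_sum, map_mul, aeval_C,
    Matrix.mul_apply, C_mul, Finset.sum_mul, Finset.mul_sum, MvPolynomial.algebraMap_eq,
    mul_assoc]
  rw [Finset.sum_comm]

lemma matSub_one : matSub (1 : Matrix (Fin ℓ) (Fin ℓ) ℝ) = AlgHom.id ℝ (Spoly ℓ) := by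
  apply MvPolynomial.algHom_ext
  intro x
  simp [matSub, Matrix.one_apply, apply_ite MvPolynomial.C, ite_mul, Finset.sum_ite_eq]

lemma matSub_injective (g : Matrix.GeneralLinearGroup (Fin ℓ) ℝ) :
    Function.Injective (matSub (↑g : Matrix (Fin ℓ) (Fin ℓ) ℝ)) := by
  intro p q h
  have h3 : (matSub (↑g⁻¹ : Matrix (Fin ℓ) (Fin ℓ) ℝ)).comp
      (matSub (↑g : Matrix (Fin ℓ) (Fin ℓ) ℝ)) = AlgHom.id ℝ (Spoly ℓ) := by
    rw [matSub_comp]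
    have h1 : ((↑g : Matrix (Fin ℓ) (Fin ℓ) ℝ) * (↑g⁻¹ : Matrix (Fin ℓ) (Fin ℓ) ℝ))
        = (1 : Matrix (Fin ℓ) (Fin ℓ) ℝ) := by
      rw [← Units.val_mul]; simp
    rw [h1, matSub_one]
  have h2 := congrArg (matSub (↑g⁻¹ : Matrix (Fin ℓ) (Fin ℓ) ℝ)) h
  rwa [← AlgHom.comp_apply, ← AlgHom.comp_apply, h3, AlgHom.id_apply, AlgHom.id_apply] at h2

/-- The action of `g ∈ GL_ℓ(ℝ)` on rational functions, `f ↦ f ∘ g⁻¹`. -/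
def fAct (g : Matrix.GeneralLinearGroup (Fin ℓ) ℝ) : Ffield ℓ →+* Ffield ℓ :=
  IsFractionRing.lift (g :=
    (algebraMap (Spoly ℓ) (Ffield ℓ)).comp
      (matSub (↑g⁻¹ : Matrix (Fin ℓ) (Fin ℓ) ℝ)).toRingHom)
    ((IsFractionRing.injective (Spoly ℓ) (Ffield ℓ)).comp (matSub_injective g⁻¹))

/-- The natural action of an **orthogonal** `g` on the component vector of a
differential 1-form (equivalently, of a derivation): `(g·v)_x = Σ_y g_{x y} · g(v_y)`. -/
def vecAct (g : Matrix.GeneralLinearGroup (Fin ℓ) ℝ) (v : OmF ℓ) : OmF ℓ :=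
  fun x => ∑ y, cF ((↑g : Matrix (Fin ℓ) (Fin ℓ) ℝ) x y) * fAct g (v y)

/-- `W`-invariant component vectors (1-forms/derivations). -/
def InvVec (W : Subgroup (Matrix.GeneralLinearGroup (Fin ℓ) ℝ)) : Set (OmF ℓ) :=
  {ω | ∀ g ∈ W, vecAct g ω = ω}

/-- `Ω(A,∞)^W`. -/
def OmegaInfW (A : Finset (Fin ℓ → ℝ)) (W : Subgroup (Matrix.GeneralLinearGroup (Fin ℓ) ℝ)) :
    Set (OmF ℓ) := OmegaInf A ∩ InvVec W

/-- `Ω(A,m)^W = Ω(A,m) ∩ Ω(A,∞)^W`. -/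
def OmegaMultW (A : Finset (Fin ℓ → ℝ)) (W : Subgroup (Matrix.GeneralLinearGroup (Fin ℓ) ℝ))
    (m : (Fin ℓ → ℝ) → ℤ) : Set (OmF ℓ) := OmegaMult A m ∩ InvVec W

/-- `W`-invariant polynomials. -/
def InvPoly (W : Subgroup (Matrix.GeneralLinearGroup (Fin ℓ) ℝ)) : Set (Spoly ℓ) :=
  {p | ∀ g ∈ W, matSub (↑g : Matrix (Fin ℓ) (Fin ℓ) ℝ) p = p}

/-- The invariant ring `R = S^W`, viewed inside `F`. -/
def RF (W : Subgroup (Matrix.GeneralLinearGroup (Fin ℓ) ℝ)) : Set (Ffield ℓ) :=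
  toF '' InvPoly W

/-- The orthogonal reflection through the hyperplane `ker⟨a, ·⟩`. -/
def reflMat (a : Fin ℓ → ℝ) : Matrix (Fin ℓ) (Fin ℓ) ℝ :=
  1 - (2 / ∑ x, a x * a x) • Matrix.vecMulVec a a

/-! ### Block (irreducible-factor) structure. -/

/-- A polynomial involving only the variables of the block `i` (w.r.t. the block
assignment `blk : Fin ℓ → Fin t`). -/
def blockPoly (blk : Fin ℓ → Fin t) (i : Fin t) (p : Spoly ℓ) : Prop :=
  ∀ m ∈ p.support, ∀ x ∈ Finsupp.support m, blk x = i

/-- Rational functions in the variables of block `i` only. -/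
def blockFrac (blk : Fin ℓ → Fin t) (i : Fin t) : Set (Ffield ℓ) :=
  {y | ∃ p q : Spoly ℓ, blockPoly blk i p ∧ blockPoly blk i q ∧ q ≠ 0 ∧ y * toF q = toF p}

/-- A component vector belonging to the factor `V[i]`:  components outside block `i`
vanish and all components are rational functions of the block-`i` variables. -/
def BlockVec (blk : Fin ℓ → Fin t) (i : Fin t) (ω : OmF ℓ) : Prop :=
  (∀ x, blk x ≠ i → ω x = 0) ∧ ∀ x, ω x ∈ blockFrac blk i

/-- All the data of a (not necessarily irreducible) Coxeter arrangement `A` in the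
Euclidean space `V = ℝ^ℓ`, together with its decomposition into `t` irreducible
factors and a system of basic invariants:

* `A` is a finite set of hyperplanes, recorded by nonzero defining normal vectors,
  pairwise non-proportional;
* `W` is a finite subgroup of `GL_ℓ(ℝ)` consisting of orthogonal transformations,
  generated by the reflections through the members of `A`, and `A` is exactly the
  set of reflecting hyperplanes of `W` (so `A` is the Coxeter arrangement of the
  finite real reflection group `W`);
* `blk` assigns to every coordinate its irreducible block `V[i]`, every hyperplane
  of `A` lies over a single block;
* `P c` (`c : Fin ℓ`) are basic invariants: homogeneous, `W`-invariant,
  algebraically independent generators of `R = S^W`, the invariants of the block `i`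
  being those `P c` with `blk c = i` and involving only block-`i` variables;
* within each block `i` the invariant `P (top i)` has strictly largest degree
  (this uses irreducibility of the factors; it makes the primitive derivations
  `D[i] = ∂/∂P_{ℓ[i]}[i]` well defined up to constants). -/
structure CoxeterSetup (ℓ t : ℕ) where
  A : Finset (Fin ℓ → ℝ)
  W : Subgroup (Matrix.GeneralLinearGroup (Fin ℓ) ℝ)
  hA0 : ∀ a ∈ A, a ≠ 0
  hAprop : ∀ a ∈ A, ∀ b ∈ A, (∃ c : ℝ, a = c • b) → a = b
  hWfin : (W : Set (Matrix.GeneralLinearGroup (Fin ℓ) ℝ)).Finite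
  hWorth : ∀ g ∈ W, Matrix.transpose (↑g : Matrix (Fin ℓ) (Fin ℓ) ℝ) * (↑g : Matrix (Fin ℓ) (Fin ℓ) ℝ) = 1
  hrefl : ∀ a ∈ A, ∃ g ∈ W, (↑g : Matrix (Fin ℓ) (Fin ℓ) ℝ) = reflMat a
  hhyp : ∀ g ∈ W, ∀ a : Fin ℓ → ℝ, a ≠ 0 → (↑g : Matrix (Fin ℓ) (Fin ℓ) ℝ) = reflMat a →
    ∃ b ∈ A, ∃ c : ℝ, a = c • b
  hgen : W = Subgroup.closure
    {g : Matrix.GeneralLinearGroup (Fin ℓ) ℝ | ∃ a ∈ A, (↑g : Matrix (Fin ℓ) (Fin ℓ) ℝ) = reflMat a}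
  blk : Fin ℓ → Fin t
  hblkA : ∀ a ∈ A, ∃ i, ∀ x, a x ≠ 0 → blk x = i
  P : Fin ℓ → MvPolynomial (Fin ℓ) ℝ
  deg : Fin ℓ → ℕ
  hdeg : ∀ c, 0 < deg c
  hPhom : ∀ c, (P c).IsHomogeneous (deg c)
  hPblock : ∀ c, blockPoly blk (blk c) (P c)
  hPinv : ∀ c, P c ∈ InvPoly W
  hPind : AlgebraicIndependent ℝ P
  hPgen : ∀ p : Spoly ℓ, p ∈ InvPoly W ↔ p ∈ Algebra.adjoin ℝ (Set.range P)
  top : Fin t → Fin ℓ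
  htop : ∀ i, blk (top i) = i
  htopdeg : ∀ i c, blk c = i → c ≠ top i → deg c < deg (top i)

/-! ### Primitive derivations and the connection `∇_D`. -/

/-- The covariant derivative `∇_D` on rational 1-forms: since `∇_D (dx_x) = 0`,
it acts componentwise, `∇_D(Σ f_x dx_x) = Σ D(f_x) dx_x`. -/
def nabVec (D : Derivation ℝ (Ffield ℓ) (Ffield ℓ)) (ω : OmF ℓ) : OmF ℓ :=
  fun x => D (ω x)

/-- `T = ker (D : R → R)`, viewed inside `F`. -/
def TF (W : Subgroup (Matrix.GeneralLinearGroup (Fin ℓ) ℝ))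
    (D : Derivation ℝ (Ffield ℓ) (Ffield ℓ)) : Set (Ffield ℓ) :=
  {y ∈ RF W | D y = 0}

/-- The differential `dP` of a polynomial, as a component vector: `(dP)_x = ∂P/∂x_x`. -/
def dPoly (p : Spoly ℓ) : OmF ℓ := fun x => toF (MvPolynomial.pderiv x p)

/-! ### Freeness of a submodule over a subring of coefficients. -/

/-- `v : ι → M` is a basis of the sub-`C`-module `Mod ⊆ M` over the coefficient
set `C ⊆ F`: the members of the family lie in `Mod`, every element of `Mod`
is a finite `C`-linear combination of them, and they are linearly independent
over `C`. -/
def IsBasisOver {ℓ : ℕ} {ι M : Type*} [AddCommMonoid M] [Module (Ffield ℓ) M]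
    (C : Set (Ffield ℓ)) (Mod : Set M) (v : ι → M) : Prop :=
  (∀ j, v j ∈ Mod) ∧
  (∀ ω ∈ Mod, ∃ c : ι →₀ Ffield ℓ, (∀ j, c j ∈ C) ∧ ω = c.sum fun j a => a • v j) ∧
  (∀ c : ι →₀ Ffield ℓ, (∀ j, c j ∈ C) → (c.sum fun j a => a • v j) = 0 → c = 0)

/-! ### Order of poles along a hyperplane. -/

/-- The localization `S_{(α)}` of `S` at the prime ideal `(α)`, viewed in `F`:
fractions with denominator prime to `α`. -/
def Sloc (a : Fin ℓ → ℝ) : Set (Ffield ℓ) :=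
  {y | ∃ p q : Spoly ℓ, ¬ linForm a ∣ q ∧ y * toF q = toF p}

/-- `ordEq a f k` says `ord_α(f) = k`, i.e. `k = min {j : α^j f ∈ S_{(α)}}`. -/
def ordEq (a : Fin ℓ → ℝ) (f : Ffield ℓ) (k : ℤ) : Prop :=
  linF a ^ k * f ∈ Sloc a ∧ ∀ j : ℤ, linF a ^ j * f ∈ Sloc a → k ≤ j

/-! ### Logarithmic derivation modules. -/

/-- The module `D(A,−∞)` of logarithmic derivations (Definition 4.1):
`Q^N ξ` regular and `(Q/α_H)^N ξ(β)` regular whenever `β ⊥ α_H`. -/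
def DerInf (A : Finset (Fin ℓ → ℝ)) : Set (Derivation ℝ (Ffield ℓ) (Ffield ℓ)) :=
  {ξ | ∃ N : ℕ,
    (∀ x, QF A ^ N * ξ (XF x) ∈ Sreg ℓ) ∧
    ∀ a ∈ A, ∀ b : Fin ℓ → ℝ, (∑ x, a x * b x) = 0 →
      (QF A / linF a) ^ N * ξ (linF b) ∈ Sreg ℓ}

/-- `D(A,m)` for a multiplicity `m : A → ℤ`:
`(Q/α_H)^N ξ(α_H) ∈ α_H^{m(H)} S` for `N ≫ 0`. -/
def DerMult (A : Finset (Fin ℓ → ℝ)) (m : (Fin ℓ → ℝ) → ℤ) :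
    Set (Derivation ℝ (Ffield ℓ) (Ffield ℓ)) :=
  {ξ ∈ DerInf A | ∃ N : ℕ, ∀ a ∈ A, ∃ p : Spoly ℓ,
    (QF A / linF a) ^ N * ξ (linF a) = linF a ^ m a * toF p}

/-- The component vector of a derivation: `ξ = Σ_x ξ(x_x) ∂_x`. -/
def derVec (ξ : Derivation ℝ (Ffield ℓ) (Ffield ℓ)) : OmF ℓ := fun x => ξ (XF x)

/-- `W`-invariant derivations (via the action on component vectors; the group
consists of orthogonal transformations). -/
def InvDer (W : Subgroup (Matrix.GeneralLinearGroup (Fin ℓ) ℝ)) :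
    Set (Derivation ℝ (Ffield ℓ) (Ffield ℓ)) :=
  {ξ | ∀ g ∈ W, vecAct g (derVec ξ) = derVec ξ}

/-- `D(A,−∞)^W`. -/
def DerInfW (A : Finset (Fin ℓ → ℝ)) (W : Subgroup (Matrix.GeneralLinearGroup (Fin ℓ) ℝ)) :
    Set (Derivation ℝ (Ffield ℓ) (Ffield ℓ)) := DerInf A ∩ InvDer W

/-- `D(A,m)^W = D(A,m) ∩ D(A,−∞)^W`. -/
def DerMultW (A : Finset (Fin ℓ → ℝ)) (W : Subgroup (Matrix.GeneralLinearGroup (Fin ℓ) ℝ))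
    (m : (Fin ℓ → ℝ) → ℤ) : Set (Derivation ℝ (Ffield ℓ) (Ffield ℓ)) :=
  DerMult A m ∩ InvDer W

/-- `I* : Ω_F → Der_F`, `I*(ω)(f) = I*(ω, df) = Σ_x ω_x ∂f/∂x_x`, defined using a
family `pd` of partial-derivative derivations of `F`. -/
def IstarDer (pd : Fin ℓ → Derivation ℝ (Ffield ℓ) (Ffield ℓ)) (ω : OmF ℓ) :
    Derivation ℝ (Ffield ℓ) (Ffield ℓ) :=
  ∑ x, ω x • pd x

/-- The covariant derivative `∇_D` on rational derivations: `(∇_D ξ)(α) = D(ξ(α))`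
for `α ∈ V*`, i.e. `∇_D ξ = Σ_x D(ξ(x_x)) ∂_x`. -/
def nabDer (pd : Fin ℓ → Derivation ℝ (Ffield ℓ) (Ffield ℓ))
    (D : Derivation ℝ (Ffield ℓ) (Ffield ℓ))
    (ξ : Derivation ℝ (Ffield ℓ) (Ffield ℓ)) : Derivation ℝ (Ffield ℓ) (Ffield ℓ) :=
  ∑ x, D (ξ (XF x)) • pd x

end CoxeterFormalization

section RegularityOfDerivations

variable {ℓ : ℕ}

lemma toF_mem_Sreg (p : Spoly ℓ) : toF p ∈ Sreg ℓ := ⟨p, rfl⟩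

lemma mul_mem_Sreg {f g : Ffield ℓ} (hf : f ∈ Sreg ℓ) (hg : g ∈ Sreg ℓ) : f * g ∈ Sreg ℓ :=
  (algebraMap (Spoly ℓ) (Ffield ℓ)).range.mul_mem hf hg

lemma add_mem_Sreg {f g : Ffield ℓ} (hf : f ∈ Sreg ℓ) (hg : g ∈ Sreg ℓ) : f + g ∈ Sreg ℓ :=
  (algebraMap (Spoly ℓ) (Ffield ℓ)).range.add_mem hf hg

lemma toF_injective : Function.Injective (toF : Spoly ℓ → Ffield ℓ) :=
  IsFractionRing.injective (Spoly ℓ) (Ffield ℓ)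

lemma toF_mul (p q : Spoly ℓ) : toF (p * q) = toF p * toF q := map_mul _ p q

lemma toF_add (p q : Spoly ℓ) : toF (p + q) = toF p + toF q := map_add _ p q

lemma toF_pow (p : Spoly ℓ) (n : ℕ) : toF (p ^ n) = toF p ^ n := map_pow _ p n

lemma cF_eq_algebraMap (r : ℝ) : (cF r : Ffield ℓ) = algebraMap ℝ (Ffield ℓ) r := by
  rw [IsScalarTower.algebraMap_apply ℝ (Spoly ℓ) (Ffield ℓ), MvPolynomial.algebraMap_eq]
  rfl

lemma derivation_cF_mul (ξ : Derivation ℝ (Ffield ℓ) (Ffield ℓ)) (r : ℝ) (f : Ffield ℓ) :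
    ξ (cF r * f) = cF r * ξ f := by
  rw [cF_eq_algebraMap, ← Algebra.smul_def, Derivation.map_smul, Algebra.smul_def]

lemma derivation_toF_mem_Sreg {ξ : Derivation ℝ (Ffield ℓ) (Ffield ℓ)}
    (h : ∀ x, ξ (XF x) ∈ Sreg ℓ) (p : Spoly ℓ) : ξ (toF p) ∈ Sreg ℓ := by
  induction p using MvPolynomial.induction_on with
  | C r =>
    have : ξ (toF (C r)) = 0 := by
      rw [← cF, cF_eq_algebraMap, Derivation.map_algebraMap]
    rw [this]
    exact ⟨0, map_zero _⟩
  | add p q hp hq =>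
    rw [toF_add, map_add]
    exact add_mem_Sreg hp hq
  | mul_X p x hp =>
    rw [toF_mul, Derivation.leibniz, smul_eq_mul, smul_eq_mul]
    exact add_mem_Sreg (mul_mem_Sreg (toF_mem_Sreg _) (h x)) (mul_mem_Sreg (toF_mem_Sreg _) hp)

lemma coeff_linForm (a : Fin ℓ → ℝ) (i : Fin ℓ) :
    (linForm a).coeff (Finsupp.single i 1) = a i := by
  classical
  simp [linForm, coeff_sum, coeff_C_mul, coeff_X, Finsupp.single_left_inj]

lemma eval_linForm (a v : Fin ℓ → ℝ) : eval v (linForm a) = ∑ x, a x * v x := by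
  simp [linForm]

lemma linForm_ne_zero {a : Fin ℓ → ℝ} (ha : a ≠ 0) : linForm a ≠ 0 := by
  obtain ⟨i, hi⟩ := Function.ne_iff.mp ha
  intro h
  exact hi (by rw [← coeff_linForm a, h, coeff_zero, Pi.zero_apply])

lemma totalDegree_linForm {a : Fin ℓ → ℝ} (ha : a ≠ 0) : (linForm a).totalDegree = 1 := by
  refine IsHomogeneous.totalDegree ?_ (linForm_ne_zero ha)
  refine IsHomogeneous.sum _ _ _ fun x _ => ?_
  simpa using (isHomogeneous_C (Fin ℓ) (a x)).mul (isHomogeneous_X ℝ x)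

lemma prime_linForm {a : Fin ℓ → ℝ} (ha : a ≠ 0) : Prime (linForm a) := by
  refine (irreducible_of_totalDegree_eq_one (totalDegree_linForm ha) fun r hr => ?_).prime
  obtain ⟨i, hi⟩ := Function.ne_iff.mp ha
  rw [isUnit_iff_ne_zero]
  rintro rfl
  exact hi (by simpa [coeff_linForm] using hr (Finsupp.single i 1))

/-- A linear form divisible by another one is a scalar multiple of it. -/
lemma exists_smul_of_linForm_dvd {a b : Fin ℓ → ℝ} (ha : a ≠ 0) (h : linForm a ∣ linForm b) :
    ∃ c : ℝ, b = c • a := by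
  have hker : ∀ v : Fin ℓ → ℝ, a ⬝ᵥ v = 0 → b ⬝ᵥ v = 0 := by
    intro v hv
    obtain ⟨q, hq⟩ := h
    have := congrArg (eval v) hq
    rw [map_mul, eval_linForm, eval_linForm] at this
    simp only [dotProduct] at hv ⊢
    rw [this, hv, zero_mul]
  have haa : a ⬝ᵥ a ≠ 0 := by simpa using ha
  refine ⟨(a ⬝ᵥ b) / (a ⬝ᵥ a), ?_⟩
  have hav : a ⬝ᵥ (b - ((a ⬝ᵥ b) / (a ⬝ᵥ a)) • a) = 0 := by
    rw [dotProduct_sub, dotProduct_smul, smul_eq_mul, div_mul_cancel₀ _ haa, sub_self]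
  rw [← sub_eq_zero, ← dotProduct_self_eq_zero]
  rw [sub_dotProduct, smul_dotProduct, hker _ hav, hav, smul_zero, sub_zero]

variable {A : Finset (Fin ℓ → ℝ)}

lemma QF_div_linF (hA0 : ∀ a ∈ A, a ≠ 0) {a : Fin ℓ → ℝ} (ha : a ∈ A) :
    QF A / linF a = toF (∏ b ∈ A.erase a, linForm b) := by
  have h : linF a ≠ 0 := fun h =>
    linForm_ne_zero (hA0 a ha) (toF_injective (h.trans (map_zero _).symm))
  rw [div_eq_iff h, QF, linF, ← toF_mul, Finset.prod_erase_mul _ _ ha]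

lemma not_linForm_dvd_prod_erase (hA0 : ∀ a ∈ A, a ≠ 0)
    (hAprop : ∀ a ∈ A, ∀ b ∈ A, (∃ c : ℝ, a = c • b) → a = b) {a : Fin ℓ → ℝ} (ha : a ∈ A)
    (N : ℕ) : ¬ linForm a ∣ (∏ b ∈ A.erase a, linForm b) ^ N := by
  intro h
  have hp := prime_linForm (hA0 a ha)
  obtain ⟨b, hb, hab⟩ := hp.exists_mem_finset_dvd (hp.dvd_of_dvd_pow h)
  rw [Finset.mem_erase] at hb
  exact hb.1 (hAprop b hb.2 a ha (exists_smul_of_linForm_dvd (hA0 a ha) hab))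

lemma den_dvd_of_toF_mul_mem_Sreg {f : Ffield ℓ} {g : Spoly ℓ} (h : toF g * f ∈ Sreg ℓ) :
    (IsFractionRing.den (Spoly ℓ) f : Spoly ℓ) ∣ g := by
  obtain ⟨s, hs⟩ := h
  have hden : toF (IsFractionRing.den (Spoly ℓ) f : Spoly ℓ) ≠ 0 := fun h0 =>
    nonZeroDivisors.coe_ne_zero _ (toF_injective (h0.trans (map_zero _).symm))
  have hf : f * toF (IsFractionRing.den (Spoly ℓ) f : Spoly ℓ) =
      toF (IsFractionRing.num (Spoly ℓ) f) :=
    (div_eq_iff hden).mp (IsFractionRing.mk'_num_den' (Spoly ℓ) f) |>.symm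
  refine (IsFractionRing.num_den_reduced (Spoly ℓ) f).symm.dvd_of_dvd_mul_right
    (z := IsFractionRing.num (Spoly ℓ) f) ⟨s, toF_injective ?_⟩
  rw [toF_mul, toF_mul, ← hf, ← mul_assoc, ← hs, mul_comm]
  rfl

/-- A rational function with poles only along `A`, and for every `H ∈ A` with poles only along
`A \ {H}`, is a polynomial. -/
lemma mem_Sreg_of_forall_pole (hA0 : ∀ a ∈ A, a ≠ 0)
    (hAprop : ∀ a ∈ A, ∀ b ∈ A, (∃ c : ℝ, a = c • b) → a = b) {f : Ffield ℓ}
    (hQ : ∃ N : ℕ, QF A ^ N * f ∈ Sreg ℓ)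
    (hQa : ∀ a ∈ A, ∃ N : ℕ, (QF A / linF a) ^ N * f ∈ Sreg ℓ) : f ∈ Sreg ℓ := by
  suffices h : IsUnit (IsFractionRing.den (Spoly ℓ) f : Spoly ℓ) from
    IsFractionRing.isInteger_of_isUnit_den h
  by_contra hunit
  obtain ⟨p, hp, hpd⟩ := WfDvdMonoid.exists_irreducible_factor hunit
    (nonZeroDivisors.coe_ne_zero _)
  obtain ⟨N, hN⟩ := hQ
  rw [QF, ← toF_pow] at hN
  obtain ⟨a, ha, hpa⟩ := hp.prime.exists_mem_finset_dvd
    (hp.prime.dvd_of_dvd_pow (hpd.trans (den_dvd_of_toF_mul_mem_Sreg hN)))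
  obtain ⟨M, hM⟩ := hQa a ha
  rw [QF_div_linF hA0 ha, ← toF_pow] at hM
  have hassoc := hp.associated_of_dvd (prime_linForm (hA0 a ha)).irreducible hpa
  exact not_linForm_dvd_prod_erase hA0 hAprop ha M
    (hassoc.symm.dvd.trans (hpd.trans (den_dvd_of_toF_mul_mem_Sreg hM)))

/-- Regularity of `g ξ` on a linear form and on the forms orthogonal to it gives regularity on
all coordinates. -/
lemma mul_derivation_XF_mem_Sreg {ξ : Derivation ℝ (Ffield ℓ) (Ffield ℓ)} {a : Fin ℓ → ℝ}
    (ha : a ≠ 0) {g : Ffield ℓ} (h : g * ξ (linF a) ∈ Sreg ℓ)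
    (horth : ∀ b : Fin ℓ → ℝ, (∑ x, a x * b x) = 0 → g * ξ (linF b) ∈ Sreg ℓ) (i : Fin ℓ) :
    g * ξ (XF i) ∈ Sreg ℓ := by
  classical
  have haa : (a ⬝ᵥ a) ≠ 0 := by simpa using ha
  set b : Fin ℓ → ℝ := Pi.single i 1 - (a i / (a ⬝ᵥ a)) • a with hb
  have hab : ∑ x, a x * b x = 0 := by
    change a ⬝ᵥ b = 0
    rw [hb, dotProduct_sub, dotProduct_smul, smul_eq_mul, div_mul_cancel₀ _ haa,
      dotProduct_single, mul_one, sub_self]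
  have hX : XF i = linF b + cF (a i / (a ⬝ᵥ a)) * linF a := by
    rw [XF, linF, linF, cF, ← toF_mul, ← toF_add]
    congr 1
    simp only [linForm, hb, Pi.sub_apply, Pi.smul_apply, smul_eq_mul, C_sub, C_mul, sub_mul,
      Finset.sum_sub_distrib, mul_assoc, ← Finset.mul_sum, sub_add_cancel]
    simp [Pi.single_apply, apply_ite (C : ℝ → Spoly ℓ)]
  rw [hX, map_add, derivation_cF_mul, mul_add, mul_left_comm]
  exact add_mem_Sreg (horth b hab) (mul_mem_Sreg (toF_mem_Sreg _) h)

lemma linF_zpow_eq_toF {a : Fin ℓ → ℝ} {n : ℤ} (hn : 0 ≤ n) :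
    linF a ^ n = toF (linForm a ^ n.toNat) := by
  rw [toF_pow, ← linF, ← zpow_natCast, Int.toNat_of_nonneg hn]

end RegularityOfDerivations

section Statements

variable {ℓ t : ℕ}

/-- for a nonnegative multiplicity `m`, `D(A,m)` coincides with
Ziegler's multiderivation module `{ξ ∈ Der_S : ξ(α_H) ∈ α_H^{m(H)} S}`. -/
theorem stmt17 (A : Finset (Fin ℓ → ℝ))
    (hA0 : ∀ a ∈ A, a ≠ 0)
    (hAprop : ∀ a ∈ A, ∀ b ∈ A, (∃ c : ℝ, a = c • b) → a = b)
    (m : (Fin ℓ → ℝ) → ℤ) (hm : ∀ a ∈ A, 0 ≤ m a) :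
    DerMult A m =
      {ξ : Derivation ℝ (Ffield ℓ) (Ffield ℓ) |
        (∀ p : Spoly ℓ, ξ (toF p) ∈ Sreg ℓ) ∧
        ∀ a ∈ A, ∃ p : Spoly ℓ, ξ (linF a) = linF a ^ m a * toF p} := by
  ext ξ
  constructor
  · rintro ⟨⟨N, hQ, horth⟩, M, hM⟩
    have hX : ∀ x, ξ (XF x) ∈ Sreg ℓ := by
      intro x
      refine mem_Sreg_of_forall_pole hA0 hAprop ⟨N, hQ x⟩ fun a ha => ⟨N + M, ?_⟩
      have hreg : ∀ k : ℕ, (QF A / linF a) ^ k ∈ Sreg ℓ := fun k => by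
        rw [QF_div_linF hA0 ha, ← toF_pow]
        exact toF_mem_Sreg _
      refine mul_derivation_XF_mem_Sreg (hA0 a ha) ?_ (fun b hb => ?_) x
      · obtain ⟨p, hp⟩ := hM a ha
        rw [pow_add, mul_assoc, hp, linF_zpow_eq_toF (hm a ha)]
        exact mul_mem_Sreg (hreg N) (mul_mem_Sreg (toF_mem_Sreg _) (toF_mem_Sreg _))
      · rw [pow_add, mul_comm (_ ^ N), mul_assoc]
        exact mul_mem_Sreg (hreg M) (horth a ha b hb)
    refine ⟨derivation_toF_mem_Sreg hX, fun a ha => ?_⟩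
    obtain ⟨q, hq⟩ := derivation_toF_mem_Sreg hX (linForm a)
    obtain ⟨p, hp⟩ := hM a ha
    rw [linF, ← hq, ← toF, ← linF, QF_div_linF hA0 ha, linF_zpow_eq_toF (hm a ha), ← toF_pow,
      ← toF_mul, ← toF_mul] at hp
    obtain ⟨r, hr⟩ := (prime_linForm (hA0 a ha)).pow_dvd_of_dvd_mul_left _
      (not_linForm_dvd_prod_erase hA0 hAprop ha M) ⟨p, toF_injective hp⟩
    refine ⟨r, ?_⟩
    rw [linF_zpow_eq_toF (hm a ha), ← toF_mul, ← hr, linF, ← hq, toF]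
  · rintro ⟨hreg, hmul⟩
    refine ⟨⟨0, fun x => ?_, fun a _ b _ => ?_⟩, 0, fun a ha => ?_⟩
    · simpa [XF] using hreg (X x)
    · simpa [linF] using hreg (linForm b)
    · simpa using hmul a ha

end Statements
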